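/- arXiv:1806.00702 — 2 statements merged into one kernel-verified Lean document; each statement's English description precedes it below -/
import Mathlib

section
/- There exists a Banach space X which is not reflexive but such that the family of Hamming graphs (([ℕ]^k, d_H))_{k∈ℕ} does not equi-coarsely embed into X. -/
open Finset Filter

/-- The Hamming distance on `[ℕ]^k`. -/
def hammingDistH {k : ℕ} (m n : Fin k → ℕ) : ℕ :=
  (Finset.univ.filter fun i => m i ≠ n i).card

/-- A Banach space is reflexive if the canonical embedding into its bidual is surjective. -/
def IsReflexiveSpace (X : Type*) [NormedAddCommGroup X] [NormedSpace ℝ X] : Prop :=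
  Function.Surjective (NormedSpace.inclusionInDoubleDual ℝ X)

/-- The family of Hamming graphs `([ℕ]^k, d_H)` equi-coarsely embeds into `X`. -/
def HammingGraphsEquiCoarselyEmbed (X : Type*) [NormedAddCommGroup X] : Prop :=
  ∃ ρ ω : ℝ → ℝ, Monotone ρ ∧ Monotone ω ∧ Tendsto ρ atTop atTop ∧
    ∃ f : ∀ k : ℕ, (Fin k → ℕ) → X,
      ∀ (k : ℕ) (m n : Fin k → ℕ), StrictMono m → StrictMono n →
        ρ (hammingDistH m n : ℝ) ≤ ‖f k m - f k n‖ ∧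
        ‖f k m - f k n‖ ≤ ω (hammingDistH m n : ℝ)

/-- The norming functionals of the predual: the smallest set of sequences which contains all
multiples `c • 1_[a,b)` with `|c| ≤ 1` and is stable under the Tsirelson operation
`(v₀, …, vₖ₋₁) ↦ 1/2 • ∑ 1_[tᵢ,tᵢ₊₁) vᵢ` for `k ≤ t₀ ≤ ⋯ ≤ tₖ`. -/
inductive IsNorming : (ℕ → ℝ) → Prop
  | interval (c : ℝ) (a b : ℕ) (hc : |c| ≤ 1) :
      IsNorming (fun n => if a ≤ n ∧ n < b then c else 0)
  | average (k : ℕ) (t : ℕ → ℕ) (ht : Monotone t) (hk : k ≤ t 0) (v : ℕ → ℕ → ℝ)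
      (hv : ∀ i, IsNorming (v i)) (w : ℕ → ℝ)
      (hw : ∀ i < k, ∀ n, t i ≤ n → n < t (i + 1) → w n = 1 / 2 * v i n)
      (h0 : ∀ n, n < t 0 ∨ t k ≤ n → w n = 0) : IsNorming w

namespace IsNorming

theorem zero : IsNorming (fun _ => 0) := by
  simpa using interval 0 0 0 (by simp)

theorem const {c : ℝ} (hc : |c| ≤ 1) (a : ℕ) :
    IsNorming (fun n => if n = a then c else 0) := by
  have h := interval c a (a + 1) hc
  have e : ∀ n, (a ≤ n ∧ n < a + 1) ↔ n = a := fun n => by omega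
  simpa only [e] using h

end IsNorming

/-- For a monotone sequence of cuts, a point of `[t₀, tₖ)` lies between two consecutive cuts. -/
theorem exists_cut_interval {t : ℕ → ℕ} {k n : ℕ} (h0 : t 0 ≤ n) (hk : n < t k) :
    ∃ i < k, t i ≤ n ∧ n < t (i + 1) := by
  induction k with
  | zero => omega
  | succ k ih =>
    rcases lt_or_ge n (t k) with h | h
    · obtain ⟨i, hi, h'⟩ := ih h
      exact ⟨i, by omega, h'⟩
    · exact ⟨k, by omega, h, hk⟩

/-- A point lies between at most one pair of consecutive cuts. -/
theorem cut_interval_unique {t : ℕ → ℕ} (ht : Monotone t) {i j n : ℕ} (hi : t i ≤ n)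
    (hi' : n < t (i + 1)) (hj : t j ≤ n) (hj' : n < t (j + 1)) : i = j := by
  rcases lt_trichotomy i j with h | h | h
  · have := ht (show i + 1 ≤ j by omega)
    omega
  · exact h
  · have := ht (show j + 1 ≤ i by omega)
    omega

namespace IsNorming

theorem abs_le_one {w : ℕ → ℝ} (hw : IsNorming w) (n : ℕ) : |w n| ≤ 1 := by
  induction hw generalizing n with
  | interval c a b hc =>
    dsimp only
    split_ifs
    · exact hc
    · simp
  | average k t ht hk v hv w hw h0 ih =>
    by_cases h : n < t 0 ∨ t k ≤ n
    · simp [h0 n h]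
    · push Not at h
      obtain ⟨i, hi, h1, h2⟩ := exists_cut_interval h.1 h.2
      rw [hw i hi n h1 h2, abs_mul, abs_of_pos (by norm_num : (0 : ℝ) < 1 / 2)]
      linarith [ih i n]

theorem neg {w : ℕ → ℝ} (hw : IsNorming w) : IsNorming (fun n => -w n) := by
  induction hw with
  | interval c a b hc =>
    have h := interval (-c) a b (by simpa using hc)
    convert h using 2 with n
    grind
  | average k t ht hk v hv w hw h0 ih =>
    refine average k t ht hk (fun i n => -v i n) ih _ (fun i hi n h1 h2 => ?_) (fun n h => ?_)
    · rw [hw i hi n h1 h2]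
      ring
    · rw [h0 n h, neg_zero]

theorem restrict {w : ℕ → ℝ} (hw : IsNorming w) (a b : ℕ) :
    IsNorming (fun n => if a ≤ n ∧ n < b then w n else 0) := by
  induction hw with
  | interval c a' b' hc =>
    have h := interval c (max a a') (min b b') hc
    simp only [max_le_iff, lt_min_iff] at h
    convert h using 2 with n
    grind
  | average k t ht hk v hv w hw h0 ih =>
    refine average k t ht hk _ ih _ (fun i hi n h1 h2 => ?_) (fun n h => ?_)
    · rw [hw i hi n h1 h2]
      split_ifs <;> simp
    · simp [h0 n h]

end IsNorming

/-- Finitely supported sequences, to be normed by the functionals of `IsNorming`. -/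
def FinSeq : Type := ℕ →₀ ℝ

namespace FinSeq

noncomputable instance : AddCommGroup FinSeq := inferInstanceAs (AddCommGroup (ℕ →₀ ℝ))

noncomputable instance : Module ℝ FinSeq := inferInstanceAs (Module ℝ (ℕ →₀ ℝ))

/-- The `n`-th unit vector. -/
noncomputable def unit (n : ℕ) : FinSeq := Finsupp.single n (1 : ℝ)

/-- The `n`-th coordinate. -/
def coord (n : ℕ) : FinSeq →ₗ[ℝ] ℝ := Finsupp.lapply n

/-- The pairing `∑ w n * x n`. -/
noncomputable def pair (w : ℕ → ℝ) : FinSeq →ₗ[ℝ] ℝ := Finsupp.linearCombination ℝ w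

/-- Restriction of a sequence to `[a, b)`. -/
noncomputable def restr (a b : ℕ) : FinSeq →ₗ[ℝ] FinSeq where
  toFun x := Finsupp.filter (fun n => a ≤ n ∧ n < b) x
  map_add' _ _ := Finsupp.filter_add
  map_smul' _ _ := Finsupp.filter_smul

theorem coord_restr (a b n : ℕ) (x : FinSeq) :
    coord n (restr a b x) = if a ≤ n ∧ n < b then coord n x else 0 :=
  Finsupp.filter_apply (fun n => a ≤ n ∧ n < b) x n

@[ext] theorem ext {x y : FinSeq} (h : ∀ n, coord n x = coord n y) : x = y := Finsupp.ext h

theorem coord_unit (m n : ℕ) : coord m (unit n) = if n = m then 1 else 0 :=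
  Finsupp.single_apply

/-- Every finitely supported sequence lives on some `[0, N)`. -/
theorem exists_bound (x : FinSeq) : ∃ N, ∀ n, N ≤ n → coord n x = 0 := by
  refine ⟨(Finsupp.support x).sup id + 1, fun n hn => ?_⟩
  by_contra h
  have h1 : n ∈ Finsupp.support x := Finsupp.mem_support_iff.2 h
  have h2 : id n ≤ (Finsupp.support x).sup id := Finset.le_sup h1
  simp only [id] at h2
  omega

theorem pair_eq_sum (w : ℕ → ℝ) (x : FinSeq) {N : ℕ} (hN : ∀ n, N ≤ n → coord n x = 0) :
    pair w x = ∑ n ∈ Finset.range N, coord n x * w n := by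
  refine Finsupp.sum_of_support_subset x (fun n hn => ?_) _ (by simp)
  by_contra h
  exact Finsupp.mem_support_iff.1 hn (hN n (by simpa using h))

theorem eq_sum (x : FinSeq) {N : ℕ} (hN : ∀ n, N ≤ n → coord n x = 0) :
    x = ∑ n ∈ Finset.range N, coord n x • unit n := by
  ext m
  simp only [map_sum, map_smul, coord_unit, smul_eq_mul, mul_ite, mul_one, mul_zero,
    Finset.sum_ite_eq', Finset.mem_range]
  split_ifs with h
  · rfl
  · exact hN m (by omega)

theorem pair_congr {w w' : ℕ → ℝ} {x x' : FinSeq}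
    (h : ∀ n, coord n x * w n = coord n x' * w' n) : pair w x = pair w' x' := by
  obtain ⟨N, hN⟩ := exists_bound x
  obtain ⟨N', hN'⟩ := exists_bound x'
  rw [pair_eq_sum w x (N := max N N') (fun n hn => hN n (by omega)),
    pair_eq_sum w' x' (N := max N N') (fun n hn => hN' n (by omega))]
  exact Finset.sum_congr rfl fun n _ => h n

theorem pair_unit (w : ℕ → ℝ) (n : ℕ) : pair w (unit n) = w n := by
  refine (Finsupp.linearCombination_single ℝ (1 : ℝ) n).trans ?_
  simp

theorem pair_neg (w : ℕ → ℝ) (x : FinSeq) : pair (fun n => -w n) x = -pair w x := by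
  rw [← map_neg]
  exact pair_congr fun n => by rw [map_neg]; ring

theorem pair_restrict (w : ℕ → ℝ) (a b : ℕ) (x : FinSeq) :
    pair (fun n => if a ≤ n ∧ n < b then w n else 0) x = pair w (restr a b x) :=
  pair_congr fun n => by
    rw [coord_restr]
    split_ifs <;> simp

theorem restr_eq_self {a b : ℕ} {x : FinSeq} (h : ∀ n, n < a ∨ b ≤ n → coord n x = 0) :
    restr a b x = x := by
  ext n
  rw [coord_restr]
  split_ifs with h'
  · rfl
  · exact (h n (by omega)).symm

theorem restr_add_restr {a b c : ℕ} (hab : a ≤ b) (hbc : b ≤ c) (x : FinSeq) :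
    restr a b x + restr b c x = restr a c x := by
  ext n
  rw [map_add, coord_restr, coord_restr, coord_restr]
  by_cases h1 : n < b <;> by_cases h2 : a ≤ n <;> by_cases h3 : n < c <;> by_cases h4 : b ≤ n <;>
    simp [h1, h2, h3, h4] <;> omega

noncomputable instance : Norm FinSeq :=
  ⟨fun x => sSup {r | ∃ w, IsNorming w ∧ r = pair w x}⟩

theorem bddAbove_pair (x : FinSeq) : BddAbove {r | ∃ w, IsNorming w ∧ r = pair w x} := by
  obtain ⟨N, hN⟩ := exists_bound x
  refine ⟨∑ n ∈ Finset.range N, |coord n x|, ?_⟩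
  rintro r ⟨w, hw, rfl⟩
  rw [pair_eq_sum w x hN]
  refine Finset.sum_le_sum fun n _ => (le_abs_self _).trans ?_
  rw [abs_mul]
  exact mul_le_of_le_one_right (abs_nonneg _) (hw.abs_le_one n)

theorem pair_le_norm {w : ℕ → ℝ} (hw : IsNorming w) (x : FinSeq) : pair w x ≤ ‖x‖ :=
  le_csSup (bddAbove_pair x) ⟨w, hw, rfl⟩

theorem abs_pair_le_norm {w : ℕ → ℝ} (hw : IsNorming w) (x : FinSeq) : |pair w x| ≤ ‖x‖ :=
  abs_le'.2 ⟨pair_le_norm hw x, by rw [← pair_neg]; exact pair_le_norm hw.neg x⟩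

theorem norm_le_of_pair_le {x : FinSeq} {C : ℝ} (h : ∀ w, IsNorming w → pair w x ≤ C) :
    ‖x‖ ≤ C :=
  csSup_le ⟨_, _, IsNorming.zero, rfl⟩ (by rintro r ⟨w, hw, rfl⟩; exact h w hw)

theorem exists_lt_pair (x : FinSeq) {r : ℝ} (h : r < ‖x‖) : ∃ w, IsNorming w ∧ r < pair w x := by
  by_contra! h'
  exact absurd (norm_le_of_pair_le h') (not_le.2 h)

theorem norm_nonneg' (x : FinSeq) : 0 ≤ ‖x‖ :=
  (abs_nonneg _).trans (abs_pair_le_norm IsNorming.zero x)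

theorem core : SeminormedSpace.Core ℝ FinSeq where
  norm_nonneg := norm_nonneg'
  norm_smul c x := by
    have key : ∀ (c : ℝ) (x : FinSeq), ‖c • x‖ ≤ ‖c‖ * ‖x‖ := fun c x =>
      norm_le_of_pair_le fun w hw => by
        rw [map_smul, smul_eq_mul]
        refine (le_abs_self _).trans ?_
        rw [abs_mul, Real.norm_eq_abs]
        exact mul_le_mul_of_nonneg_left (abs_pair_le_norm hw x) (abs_nonneg c)
    refine le_antisymm (key c x) ?_
    rcases eq_or_ne c 0 with rfl | hc
    · simpa using norm_nonneg' _
    · have h := key c⁻¹ (c • x)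
      rw [inv_smul_smul₀ hc, norm_inv] at h
      rwa [← le_inv_mul_iff₀ (norm_pos_iff.2 hc)]
  norm_triangle x y := norm_le_of_pair_le fun w hw => by
    rw [map_add]
    exact add_le_add (pair_le_norm hw x) (pair_le_norm hw y)

theorem abs_coord_le (m : ℕ) (x : FinSeq) : |coord m x| ≤ ‖x‖ := by
  have h1 : coord m x = pair (fun n => if n = m then 1 else 0) (coord m x • unit m) := by
    rw [map_smul, pair_unit]
    simp
  have h2 : pair (fun n => if n = m then (1 : ℝ) else 0) (coord m x • unit m) =
      pair (fun n => if n = m then 1 else 0) x := pair_congr fun j => by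
    rw [map_smul, coord_unit]
    by_cases h : j = m <;> simp [h]
  rw [h1, h2]
  exact abs_pair_le_norm (.const (by simp) m) x

noncomputable instance : NormedAddCommGroup FinSeq :=
  NormedAddCommGroup.ofCore (𝕜 := ℝ)
    { core with
      norm_eq_zero_iff x := by
        refine ⟨fun h => ext fun n => ?_, ?_⟩
        · have := abs_coord_le n x
          rw [h] at this
          simpa using this
        · rintro rfl
          exact le_antisymm (norm_le_of_pair_le fun w _ => by simp) (norm_nonneg' 0) }

noncomputable instance : NormedSpace ℝ FinSeq where
  norm_smul_le c x := (core.norm_smul c x).le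

theorem norm_restr_le (a b : ℕ) (x : FinSeq) : ‖restr a b x‖ ≤ ‖x‖ :=
  norm_le_of_pair_le fun w hw => by
    rw [← pair_restrict]
    exact pair_le_norm (hw.restrict a b) x

theorem norm_unit_le (n : ℕ) : ‖unit n‖ ≤ 1 :=
  norm_le_of_pair_le fun w hw => by
    rw [pair_unit]
    exact (abs_le.1 (hw.abs_le_one n)).2

/-- The Tsirelson inequality: admissible interval projections sum up in norm. -/
theorem sum_norm_restr_le {k : ℕ} {t : ℕ → ℕ} (ht : Monotone t) (hk : k ≤ t 0) (x : FinSeq) :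
    ∑ i ∈ Finset.range k, ‖restr (t i) (t (i + 1)) x‖ ≤ 2 * ‖x‖ := by
  refine le_of_forall_pos_le_add fun ε hε => ?_
  have hε' : 0 < ε / (k + 1) := by positivity
  choose v hv hvx using fun i => exists_lt_pair (restr (t i) (t (i + 1)) x)
    (sub_lt_self _ hε')
  let w : ℕ → ℝ := fun n =>
    ∑ i ∈ Finset.range k, if t i ≤ n ∧ n < t (i + 1) then 1 / 2 * v i n else 0
  have hw : IsNorming w := by
    refine .average k t ht hk v hv w (fun i hi n h1 h2 => ?_) (fun n h => ?_)
    · refine (Finset.sum_eq_single i (fun j _ hji => if_neg fun hj => hji ?_) ?_).trans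
        (if_pos ⟨h1, h2⟩)
      · exact cut_interval_unique ht hj.1 hj.2 h1 h2
      · exact fun h => absurd (Finset.mem_range.2 hi) h
    · refine Finset.sum_eq_zero fun i hi => if_neg ?_
      have h3 := ht (Nat.zero_le i)
      have h4 := ht (show i + 1 ≤ k from Finset.mem_range.1 hi)
      omega
  have hpair : pair w x = ∑ i ∈ Finset.range k, 1 / 2 * pair (v i) (restr (t i) (t (i + 1)) x) := by
    obtain ⟨N, hN⟩ := exists_bound x
    rw [pair_eq_sum w x hN]
    simp only [w, Finset.mul_sum]
    rw [Finset.sum_comm]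
    refine Finset.sum_congr rfl fun i _ => ?_
    rw [← pair_restrict, pair_eq_sum _ x hN, Finset.mul_sum]
    refine Finset.sum_congr rfl fun n _ => ?_
    split_ifs <;> ring
  have h1 := pair_le_norm hw x
  rw [hpair, ← Finset.mul_sum] at h1
  have h2 : ∑ i ∈ Finset.range k, ‖restr (t i) (t (i + 1)) x‖ ≤
      ∑ i ∈ Finset.range k, (pair (v i) (restr (t i) (t (i + 1)) x) + ε / (k + 1)) :=
    Finset.sum_le_sum fun i _ => by linarith [hvx i]
  rw [Finset.sum_add_distrib, Finset.sum_const, Finset.card_range, nsmul_eq_mul] at h2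
  have h3 : (k : ℝ) * (ε / (k + 1)) ≤ ε := by
    rw [mul_div_assoc', div_le_iff₀ (by positivity)]
    nlinarith
  linarith

/-- The linear functional `∑ x n`. -/
noncomputable def total : FinSeq →ₗ[ℝ] ℝ := pair fun _ => 1

theorem sum_inside_le_one {n : ℕ → ℕ} (hn : Monotone n) (t r : ℕ) :
    ∑ j ∈ Finset.range r, (if n j < t ∧ t < n (j + 1) then (1 : ℝ) else 0) ≤ 1 := by
  rw [Finset.sum_boole]
  exact_mod_cast Finset.card_le_one.2 fun i hi j hj => by
    simp only [Finset.mem_filter] at hi hj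
    exact cut_interval_unique hn hi.2.1.le hi.2.2 hj.2.1.le hj.2.2

theorem pair_interval_le {a b : ℕ} {z : FinSeq} (hz : ∀ n, n < a ∨ b ≤ n → coord n z = 0)
    (hz0 : total z = 0) (hz1 : ‖z‖ ≤ 1) {c : ℝ} (hc : |c| ≤ 1) (p q : ℕ) :
    pair (fun n => if p ≤ n ∧ n < q then c else 0) z ≤
      (if a < p ∧ p < b then 1 else 0) + (if a < q ∧ q < b then 1 else 0) := by
  have h1 : pair (fun n => if p ≤ n ∧ n < q then c else 0) z ≤ 1 :=
    (pair_le_norm (.interval c p q hc) z).trans hz1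
  by_cases hp : a < p ∧ p < b
  · rw [if_pos hp]
    split_ifs <;> linarith
  by_cases hq : a < q ∧ q < b
  · rw [if_pos hq]
    split_ifs; linarith
  rw [if_neg hp, if_neg hq, add_zero]
  by_cases h : p ≤ a ∧ b ≤ q
  · have : pair (fun n => if p ≤ n ∧ n < q then c else 0) z = pair (fun _ => 1) (c • z) :=
      pair_congr fun n => by
        rw [map_smul]
        by_cases hn : n < a ∨ b ≤ n
        · simp [hz n hn]
        · rw [if_pos (by omega), smul_eq_mul]
          ring
    rw [this, map_smul]
    change c • total z ≤ 0
    simp [hz0]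
  · have : pair (fun n => if p ≤ n ∧ n < q then c else 0) z = pair (fun _ => 1) 0 :=
      pair_congr fun n => by
        by_cases hn : n < a ∨ b ≤ n
        · simp [hz n hn]
        · rw [if_neg (by omega)]
          simp
    rw [this, map_zero]

theorem pair_average_le {a b : ℕ} {z : FinSeq} (hz : ∀ n, n < a ∨ b ≤ n → coord n z = 0)
    (hz1 : ‖z‖ ≤ 1) {k : ℕ} {t : ℕ → ℕ} (ht : Monotone t) (hk : k ≤ t 0) {v : ℕ → ℕ → ℝ}
    (hv : ∀ i, IsNorming (v i)) {w : ℕ → ℝ}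
    (hw : ∀ i < k, ∀ n, t i ≤ n → n < t (i + 1) → w n = 1 / 2 * v i n)
    (h0 : ∀ n, n < t 0 ∨ t k ≤ n → w n = 0) :
    pair w z ≤ 1 / 2 + 1 / 2 * ∑ i ∈ Finset.range (k + 1), if a < t i ∧ t i < b then 1 else 0 := by
  by_cases hin : ∃ i < k + 1, a < t i ∧ t i < b
  · obtain ⟨i, hi, h⟩ := hin
    have h1 : (1 : ℝ) ≤ ∑ i ∈ Finset.range (k + 1), if a < t i ∧ t i < b then 1 else 0 := by
      refine le_trans ?_ (Finset.single_le_sum (fun j _ => ?_) (Finset.mem_range.2 hi))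
      · rw [if_pos h]
      · split_ifs <;> norm_num
    have h2 := pair_le_norm (.average k t ht hk v hv w hw h0) z
    linarith
  · push Not at hin
    have h1 : (0 : ℝ) ≤ ∑ i ∈ Finset.range (k + 1), if a < t i ∧ t i < b then 1 else 0 :=
      Finset.sum_nonneg fun i _ => by split_ifs <;> norm_num
    by_cases hmeet : ∃ n, a ≤ n ∧ n < b ∧ t 0 ≤ n ∧ n < t k
    · obtain ⟨n, hna, hnb, hn0, hnk⟩ := hmeet
      obtain ⟨i, hi, hi1, hi2⟩ := exists_cut_interval hn0 hnk
      have h2 : t i ≤ a := by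
        by_contra h
        have := hin i (by omega) (by omega)
        omega
      have h3 : b ≤ t (i + 1) := hin (i + 1) (by omega) (by omega)
      have : pair w z = pair (v i) ((1 / 2 : ℝ) • z) := pair_congr fun m => by
        rw [map_smul, smul_eq_mul]
        by_cases hm : m < a ∨ b ≤ m
        · simp [hz m hm]
        · rw [hw i hi m (by omega) (by omega)]
          ring
      rw [this, map_smul, smul_eq_mul]
      linarith [pair_le_norm (hv i) z]
    · push Not at hmeet
      have : pair w z = pair w 0 := pair_congr fun m => by
        by_cases hm : m < a ∨ b ≤ m
        · simp [hz m hm]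
        · rw [h0 m, map_zero]
          · ring
          · by_contra! h
            have := hmeet m (by omega) (by omega) h.1
            omega
      rw [this, map_zero]
      linarith

theorem norm_add_avg_le {n : ℕ → ℕ} (hn : Monotone n) {z : ℕ → FinSeq}
    (hz : ∀ j m, m < n j ∨ n (j + 1) ≤ m → coord m (z j) = 0) (hz0 : ∀ j, total (z j) = 0)
    (hz1 : ∀ j, ‖z j‖ ≤ 1) {r : ℕ} (hr : 4 * (n 1 + 1) ≤ r) :
    ‖z 0 + (1 / r : ℝ) • ∑ j ∈ Finset.range r, z (j + 1)‖ ≤ 7 / 4 := by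
  have hr0 : (4 : ℝ) * (n 1 + 1) ≤ r := by exact_mod_cast hr
  have hrpos : (0 : ℝ) < r := by
    have : (0 : ℝ) ≤ n 1 := by positivity
    linarith
  have hn' : Monotone fun j => n (j + 1) := fun i j h => hn (by omega)
  refine norm_le_of_pair_le fun w hw => ?_
  rw [map_add, map_smul, map_sum, smul_eq_mul]
  suffices h : r * pair w (z 0) + ∑ j ∈ Finset.range r, pair w (z (j + 1)) ≤ 7 / 4 * r by
    have : pair w (z 0) + 1 / r * ∑ j ∈ Finset.range r, pair w (z (j + 1)) =
        (r * pair w (z 0) + ∑ j ∈ Finset.range r, pair w (z (j + 1))) / r := by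
      field_simp
    rw [this, div_le_iff₀ hrpos]
    exact h
  have hle : ∀ j, pair w (z j) ≤ 1 := fun j => (pair_le_norm hw _).trans (hz1 j)
  have hsum : ∑ j ∈ Finset.range r, pair w (z (j + 1)) ≤ r := by
    simpa using Finset.sum_le_sum fun j (_ : j ∈ Finset.range r) => hle (j + 1)
  have hn1 : (0 : ℝ) ≤ n 1 := by positivity
  cases hw with
  | interval c p q hc =>
    have h1 := Finset.sum_le_sum fun j (_ : j ∈ Finset.range r) =>
      pair_interval_le (hz (j + 1)) (hz0 _) (hz1 _) hc p q
    rw [Finset.sum_add_distrib] at h1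
    have h2 := sum_inside_le_one hn' p r
    have h3 := sum_inside_le_one hn' q r
    nlinarith [hle 0]
  | average k t ht hk v hv _ hw h0 =>
    rcases le_or_gt (n 1) (t 0) with h | h
    · have : pair w (z 0) = pair w 0 := pair_congr fun m => by
        by_cases hm : n 1 ≤ m
        · simp [hz 0 m (Or.inr hm)]
        · rw [h0 m (Or.inl (by omega))]
          simp
      rw [this, map_zero]
      linarith
    · have h1 := Finset.sum_le_sum fun j (_ : j ∈ Finset.range r) =>
        pair_average_le (hz (j + 1)) (hz1 _) ht hk hv hw h0
      rw [Finset.sum_add_distrib, ← Finset.mul_sum, Finset.sum_comm] at h1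
      have h2 := Finset.sum_le_sum fun i (_ : i ∈ Finset.range (k + 1)) =>
        sum_inside_le_one hn' (t i) r
      have h3 : (k : ℝ) ≤ n 1 := by exact_mod_cast (by omega : k ≤ n 1)
      simp only [Finset.sum_const, Finset.card_range, nsmul_eq_mul, mul_one, Nat.cast_add,
        Nat.cast_one] at h1 h2
      nlinarith [hle 0]

/-- Membership in the unit ball of zero-sum sequences supported on `[n, ∞)`. -/
def IsBalanced (n : ℕ) (z : FinSeq) : Prop :=
  (∀ m < n, coord m z = 0) ∧ total z = 0 ∧ ‖z‖ ≤ 1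

theorem IsBalanced.zero (n : ℕ) : IsBalanced n 0 := by
  simp [IsBalanced]

theorem exists_balanced_contraction (y : FinSeq →ₗ[ℝ] ℝ) {n₀ : ℕ} {θ : ℝ}
    (h : ∀ z, IsBalanced n₀ z → y z ≤ θ) : ∃ n, ∀ z, IsBalanced n z → y z ≤ 9 / 10 * θ := by
  by_contra! hcon
  choose z hzb hzy using hcon
  have hθ : 0 ≤ θ := by simpa using h 0 (IsBalanced.zero _)
  choose e he using fun n => exists_bound (z n)
  let c : ℕ → ℕ := fun j => (fun n => max n (e n))^[j] n₀
  have hcs : ∀ j, c (j + 1) = max (c j) (e (c j)) := fun j =>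
    Function.iterate_succ_apply' _ _ _
  have hc : Monotone c := monotone_nat_of_le_succ fun j => by
    rw [hcs]
    exact le_max_left _ _
  have hblock : ∀ j m, m < c j ∨ c (j + 1) ≤ m → coord m (z (c j)) = 0 := by
    rintro j m (hm | hm)
    · exact (hzb _).1 m hm
    · refine he _ m (le_trans ?_ hm)
      rw [hcs]
      exact le_max_right _ _
  obtain ⟨r, hr⟩ : ∃ r, r = 4 * (c 1 + 1) := ⟨_, rfl⟩
  have hrpos : (0 : ℝ) < r := by rw [hr]; positivity
  have hnorm := norm_add_avg_le hc (z := fun j => z (c j)) hblock (fun j => (hzb _).2.1)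
    (fun j => (hzb _).2.2) hr.ge
  set x : FinSeq := z (c 0) + (1 / r : ℝ) • ∑ j ∈ Finset.range r, z (c (j + 1)) with hx
  have hbal : IsBalanced n₀ ((4 / 7 : ℝ) • x) := by
    refine ⟨fun m hm => ?_, ?_, ?_⟩
    · have h0 : ∀ j, coord m (z (c j)) = 0 := fun j =>
        (hzb _).1 m (lt_of_lt_of_le hm (hc (Nat.zero_le j)))
      simp [hx, h0]
    · simp [hx, (hzb _).2.1]
    · rw [norm_smul, Real.norm_eq_abs, abs_of_pos (by norm_num)]
      linarith
  have h1 := h _ hbal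
  have h2 : (r : ℝ) * (9 / 10 * θ) ≤ ∑ j ∈ Finset.range r, y (z (c (j + 1))) := by
    simpa using Finset.sum_le_sum fun j (_ : j ∈ Finset.range r) => (hzy (c (j + 1))).le
  have h3 : 9 / 10 * θ ≤ 1 / r * ∑ j ∈ Finset.range r, y (z (c (j + 1))) := by
    rw [one_div, ← div_eq_inv_mul, le_div_iff₀ hrpos]
    linarith
  rw [map_smul, hx, map_add, map_smul, map_sum, smul_eq_mul, smul_eq_mul] at h1
  linarith [hzy (c 0)]

theorem exists_balanced_le (y : StrongDual ℝ FinSeq) {η : ℝ} (hη : 0 < η) :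
    ∃ n, ∀ z, IsBalanced n z → y z ≤ η := by
  have key : ∀ j : ℕ, ∃ n, ∀ z, IsBalanced n z → y z ≤ (9 / 10) ^ j * ‖y‖ := by
    intro j
    induction j with
    | zero =>
      refine ⟨0, fun z hz => ?_⟩
      rw [pow_zero, one_mul]
      exact (le_abs_self _).trans (y.unit_le_opNorm z hz.2.2)
    | succ j ih =>
      obtain ⟨n, hn⟩ := ih
      obtain ⟨n', hn'⟩ := exists_balanced_contraction (y : FinSeq →ₗ[ℝ] ℝ) hn
      refine ⟨n', fun z hz => (hn' z hz).trans_eq ?_⟩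
      ring
  have hlim : Tendsto (fun j : ℕ => (9 / 10 : ℝ) ^ j * ‖y‖) atTop (nhds 0) := by
    simpa using (tendsto_pow_atTop_nhds_zero_of_lt_one (by norm_num : (0 : ℝ) ≤ 9 / 10)
      (by norm_num)).mul_const ‖y‖
  obtain ⟨j, hj⟩ := (hlim.eventually (gt_mem_nhds hη)).exists
  obtain ⟨n, hn⟩ := key j
  exact ⟨n, fun z hz => (hn z hz).trans hj.le⟩

theorem le_of_balanced_le {y : StrongDual ℝ FinSeq} {n : ℕ} {η : ℝ}
    (h : ∀ z, IsBalanced n z → y z ≤ η) {z : FinSeq} (hz : ∀ m < n, coord m z = 0)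
    (hz0 : total z = 0) : |y z| ≤ η * ‖z‖ := by
  have key : ∀ z : FinSeq, (∀ m < n, coord m z = 0) → total z = 0 → y z ≤ η * ‖z‖ := by
    intro z hz hz0
    rcases (norm_nonneg z).eq_or_lt' with h0 | hpos
    · have := y.le_opNorm z
      rw [h0, mul_zero] at this ⊢
      exact (le_abs_self _).trans this
    · have := h (‖z‖⁻¹ • z) ⟨fun m hm => by simp [hz m hm], by simp [hz0], by
        rw [norm_smul, norm_inv, norm_norm, inv_mul_cancel₀ hpos.ne']⟩
      rwa [map_smul, smul_eq_mul, inv_mul_le_iff₀ hpos, mul_comm] at this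
  refine abs_le'.2 ⟨key z hz hz0, ?_⟩
  simpa using key (-z) (fun m hm => by simp [hz m hm]) (by simp [hz0])

theorem abs_total_le (x : FinSeq) : |total x| ≤ ‖x‖ := by
  obtain ⟨N, hN⟩ := exists_bound x
  have : total x = pair (fun n => if 0 ≤ n ∧ n < N then 1 else 0) x := pair_congr fun n => by
    by_cases hn : N ≤ n
    · simp [hN n hn]
    · simp [not_le.1 hn]
  rw [this]
  exact abs_pair_le_norm (.interval 1 0 N (by simp)) x

theorem total_unit (n : ℕ) : total (unit n) = 1 := pair_unit _ n

/-- Restriction to `[a, b)` as a continuous linear map. -/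
noncomputable def restrL (a b : ℕ) : FinSeq →L[ℝ] FinSeq :=
  (restr a b).mkContinuous 1 fun x => by simpa using norm_restr_le a b x

theorem restrL_apply (a b : ℕ) (x : FinSeq) : restrL a b x = restr a b x := rfl

theorem restr_restr (a b : ℕ) (x : FinSeq) : restr a b (restr a b x) = restr a b x :=
  restr_eq_self fun n hn => by rw [coord_restr, if_neg (by omega)]

theorem norm_comp_restrL_le (a b : ℕ) (y : StrongDual ℝ FinSeq) : ‖y.comp (restrL a b)‖ ≤ ‖y‖ :=
  ContinuousLinearMap.opNorm_le_bound _ (norm_nonneg _) fun x =>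
    (y.le_opNorm _).trans (mul_le_mul_of_nonneg_left (norm_restr_le a b x) (norm_nonneg _))

/-- The dual is asymptotically `c₀` with respect to the coordinates. -/
theorem norm_sum_blocks_le {k : ℕ} {t : ℕ → ℕ} (ht : Monotone t) (hk : k ≤ t 0)
    {b : ℕ → StrongDual ℝ FinSeq} (hb : ∀ i, (b i).comp (restrL (t i) (t (i + 1))) = b i)
    {M : ℝ} (hM : ∀ i, ‖b i‖ ≤ M) : ‖∑ i ∈ Finset.range k, b i‖ ≤ 2 * M := by
  have hM0 : 0 ≤ M := (norm_nonneg _).trans (hM 0)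
  refine ContinuousLinearMap.opNorm_le_bound _ (by positivity) fun x => ?_
  rw [_root_.sum_apply]
  calc ‖∑ i ∈ Finset.range k, b i x‖
      ≤ ∑ i ∈ Finset.range k, M * ‖restr (t i) (t (i + 1)) x‖ := by
        refine norm_sum_le_of_le _ fun i _ => ?_
        rw [← hb i]
        exact (b i).le_of_opNorm_le (hM i) _
    _ ≤ 2 * M * ‖x‖ := by
        rw [← Finset.mul_sum]
        nlinarith [sum_norm_restr_le ht hk x]

/-- Bounded sequences of functionals have weak-* limits along ultrafilters. -/
theorem exists_weakStar_limit {E : Type*} [SeminormedAddCommGroup E] [NormedSpace ℝ E]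
    (U : Ultrafilter ℕ) (u : ℕ → StrongDual ℝ E) {B : ℝ} (hu : ∀ n, ‖u n‖ ≤ B) :
    ∃ φ : StrongDual ℝ E, ‖φ‖ ≤ B ∧
      ∀ x, Tendsto (fun n => u n x) U (nhds (φ x)) := by
  obtain ⟨φ, hφ, hlim⟩ := (WeakDual.isCompact_closedBall (0 : StrongDual ℝ E) B).ultrafilter_le_nhds
    (U.map fun n => StrongDual.toWeakDual (u n)) (by
      rw [le_principal_iff, Ultrafilter.mem_coe, Ultrafilter.mem_map]
      exact Filter.univ_mem' fun n => by simpa using hu n)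
  refine ⟨WeakDual.toStrongDual φ, by simpa using hφ, fun x => ?_⟩
  exact ((WeakDual.eval_continuous x).tendsto φ).comp hlim

theorem exists_coordLim : ∃ φ : StrongDual ℝ (StrongDual ℝ FinSeq), ‖φ‖ ≤ 1 ∧
    ∀ y, Tendsto (fun n => y (unit n)) (hyperfilter ℕ) (nhds (φ y)) :=
  exists_weakStar_limit (hyperfilter ℕ)
    (fun n => NormedSpace.inclusionInDoubleDual ℝ FinSeq (unit n))
    fun n => (NormedSpace.double_dual_bound ℝ FinSeq _).trans (norm_unit_le n)

/-- The functional sending `y` to the limit of its coordinates along the hyperfilter. -/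
noncomputable def coordLim : StrongDual ℝ (StrongDual ℝ FinSeq) := exists_coordLim.choose

theorem norm_coordLim_le : ‖coordLim‖ ≤ 1 := exists_coordLim.choose_spec.1

theorem tendsto_coordLim (y : StrongDual ℝ FinSeq) :
    Tendsto (fun n => y (unit n)) (hyperfilter ℕ) (nhds (coordLim y)) :=
  exists_coordLim.choose_spec.2 y

theorem abs_coordLim_le (y : StrongDual ℝ FinSeq) : |coordLim y| ≤ ‖y‖ := by
  simpa using coordLim.le_of_opNorm_le norm_coordLim_le y

/-- Up to its coordinate limit, every element of the dual has small tails. -/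
theorem exists_tail_le (y : StrongDual ℝ FinSeq) {η : ℝ} (hη : 0 < η) :
    ∃ n, ∀ b x, |y (restr n b x)| ≤ (|coordLim y| + η) * ‖x‖ := by
  obtain ⟨n, hn⟩ := exists_balanced_le y (show 0 < η / 4 by positivity)
  refine ⟨n, fun b x => ?_⟩
  have h1 : ∀ᶠ N in hyperfilter ℕ, |y (unit N)| < |coordLim y| + η / 2 :=
    (tendsto_coordLim y).abs.eventually (gt_mem_nhds (by linarith))
  obtain ⟨N, hN, hnN⟩ := (h1.and (Nat.hyperfilter_le_atTop (eventually_ge_atTop n))).exists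
  set z := restr n b x with hz
  have hzx : ‖z‖ ≤ ‖x‖ := norm_restr_le n b x
  set s := total z with hs
  have hsx : |s| ≤ ‖x‖ := (abs_total_le z).trans hzx
  have hsu : ‖s • unit N‖ ≤ ‖x‖ := by
    rw [norm_smul, Real.norm_eq_abs]
    nlinarith [norm_unit_le N, abs_nonneg s]
  have h2 : |y (z - s • unit N)| ≤ η / 4 * ‖z - s • unit N‖ := by
    refine le_of_balanced_le hn (fun m hm => ?_) ?_
    · have hnN' : n ≤ N := hnN
      rw [map_sub, map_smul, coord_unit, if_neg (by omega), hz, coord_restr, if_neg (by omega)]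
      simp
    · rw [map_sub, map_smul, total_unit, ← hs]
      simp
  have h3 : ‖z - s • unit N‖ ≤ 2 * ‖x‖ := (norm_sub_le _ _).trans (by linarith)
  have h4 : y z = y (z - s • unit N) + s * y (unit N) := by
    rw [map_sub, map_smul, smul_eq_mul]
    ring
  have h5 : |s * y (unit N)| ≤ ‖x‖ * (|coordLim y| + η / 2) := by
    rw [abs_mul]
    exact mul_le_mul hsx hN.le (abs_nonneg _) (norm_nonneg _)
  rw [h4]
  refine (abs_add_le _ _).trans ?_
  nlinarith

/-- An element of the dual with small initial coordinates and small coordinate limit is close to a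
block. -/
theorem exists_norm_sub_comp_restrL_le (y : StrongDual ℝ FinSeq) {T : ℕ} {η : ℝ} (hη : 0 < η)
    (hT : ∑ n ∈ Finset.range T, |y (unit n)| ≤ η) (hc : |coordLim y| ≤ 2 * η) :
    ∃ T', T ≤ T' ∧ ‖y - y.comp (restrL T T')‖ ≤ 4 * η := by
  obtain ⟨n, hn⟩ := exists_tail_le y hη
  refine ⟨max T n, le_max_left _ _, ContinuousLinearMap.opNorm_le_bound _ (by positivity)
    fun x => ?_⟩
  obtain ⟨b, hb⟩ := exists_bound x
  have h1 : |y (restr 0 T x)| ≤ η * ‖x‖ := by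
    rw [eq_sum (restr 0 T x) (N := T) (fun n hn => by rw [coord_restr, if_neg (by omega)]),
      map_sum]
    refine (Finset.abs_sum_le_sum_abs _ _).trans (le_trans ?_
      (mul_le_mul_of_nonneg_right hT (norm_nonneg x)))
    rw [Finset.sum_mul]
    refine Finset.sum_le_sum fun m hm => ?_
    rw [coord_restr, if_pos ⟨Nat.zero_le _, Finset.mem_range.1 hm⟩, map_smul, smul_eq_mul, abs_mul,
      mul_comm]
    exact mul_le_mul_of_nonneg_left (abs_coord_le m x) (abs_nonneg _)
  have h2 : |y (restr (max T n) (max (max T n) b) x)| ≤ 3 * η * ‖x‖ := by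
    have h3 : restr (max T n) (max (max T n) b) x =
        restr n (max (max T n) b) (restr (max T n) (max (max T n) b) x) :=
      (restr_eq_self fun m hm => by rw [coord_restr, if_neg (by omega)]).symm
    rw [h3]
    refine (hn _ _).trans ?_
    have := norm_restr_le (max T n) (max (max T n) b) x
    have := norm_nonneg (restr (max T n) (max (max T n) b) x)
    refine mul_le_mul (by linarith) (by assumption) (by assumption) (by positivity)
  have h4 : x = restr 0 T x + restr T (max T n) x + restr (max T n) (max (max T n) b) x := by
    rw [restr_add_restr (Nat.zero_le _) (le_max_left _ _),
      restr_add_restr (Nat.zero_le _) (le_max_left _ _)]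
    exact (restr_eq_self fun m hm => hb m (by omega)).symm
  have h5 : (y - y.comp (restrL T (max T n))) x =
      y (restr 0 T x) + y (restr (max T n) (max (max T n) b) x) := by
    rw [sub_apply, ContinuousLinearMap.comp_apply, restrL_apply]
    conv_lhs => rw [h4]
    simp only [map_add]
    rw [restr_restr]
    have h6 : ∀ a b c d : ℕ, (b ≤ c ∨ d ≤ a) → restr a b (restr c d x) = 0 := fun a b c d h => by
      ext m
      rw [coord_restr, coord_restr, map_zero]
      split_ifs <;> first | rfl | omega
    rw [h6 _ _ _ _ (Or.inr le_rfl), h6 _ _ _ _ (Or.inl le_rfl), map_zero]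
    ring
  rw [h5, Real.norm_eq_abs]
  refine (abs_add_le _ _).trans ?_
  linarith

/-- The dual is not reflexive: the summing functionals have no weak limit. -/
theorem not_isReflexiveSpace_dual : ¬ IsReflexiveSpace (StrongDual ℝ FinSeq) := by
  intro hrefl
  let s : ℕ → StrongDual ℝ FinSeq := fun n =>
    (pair fun m => if 0 ≤ m ∧ m < n then 1 else 0).mkContinuous 1 fun x => by
      simpa using abs_pair_le_norm (.interval 1 0 n (by simp)) x
  have hs1 : ∀ n, ‖s n‖ ≤ 1 := fun n => LinearMap.mkContinuous_norm_le _ zero_le_one _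
  have hsu : ∀ n m, s n (unit m) = if 0 ≤ m ∧ m < n then 1 else 0 := fun n m => pair_unit _ m
  obtain ⟨Λ, -, hΛ⟩ := exists_weakStar_limit (hyperfilter ℕ)
    (fun n => NormedSpace.inclusionInDoubleDual ℝ (StrongDual ℝ FinSeq) (s n)) (B := 1)
    fun n => (NormedSpace.double_dual_bound ℝ _ _).trans (hs1 n)
  obtain ⟨y, rfl⟩ := hrefl Λ
  simp only [NormedSpace.dual_def] at hΛ
  have hy : ∀ m, y (unit m) = 1 := fun m => by
    refine tendsto_nhds_unique
      (hΛ (NormedSpace.inclusionInDoubleDual ℝ FinSeq (unit m))) ?_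
    refine tendsto_const_nhds.congr' ?_
    filter_upwards [Nat.hyperfilter_le_atTop (eventually_gt_atTop m)] with n hn
    rw [NormedSpace.dual_def, hsu, if_pos ⟨Nat.zero_le _, hn⟩]
  have h1 : coordLim y = 1 := by
    refine tendsto_nhds_unique (tendsto_coordLim y) ?_
    simp only [hy]
    exact tendsto_const_nhds
  have h0 : ∀ n, coordLim (s n) = 0 := fun n => by
    refine tendsto_nhds_unique (tendsto_coordLim (s n)) (tendsto_const_nhds.congr' ?_)
    filter_upwards [Nat.hyperfilter_le_atTop (eventually_ge_atTop n)] with m hm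
    have hm' : n ≤ m := hm
    rw [hsu, if_neg (by omega)]
  have h2 := hΛ coordLim
  simp only [h0, h1] at h2
  exact zero_ne_one (tendsto_nhds_unique tendsto_const_nhds h2)

theorem eventually_gt_hyperfilter (N : ℕ) : ∀ᶠ n in hyperfilter ℕ, N < n :=
  Nat.hyperfilter_le_atTop (eventually_gt_atTop N)

theorem norm_le_of_tendsto_apply {u : ℕ → StrongDual ℝ FinSeq} {φ : StrongDual ℝ FinSeq}
    (hφ : ∀ x, Tendsto (fun n => u n x) (hyperfilter ℕ) (nhds (φ x))) {L : ℝ}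
    (hL : ∀ᶠ n in hyperfilter ℕ, ‖u n‖ ≤ L) : ‖φ‖ ≤ L := by
  obtain ⟨n, hn⟩ := hL.exists
  refine ContinuousLinearMap.opNorm_le_bound _ ((norm_nonneg _).trans hn) fun x => ?_
  exact le_of_tendsto (hφ x).norm (hL.mono fun n hn => (u n).le_of_opNorm_le hn x)

open Classical in
/-- The weak-* limit along the hyperfilter of a bounded sequence. -/
noncomputable def weakLim (u : ℕ → StrongDual ℝ FinSeq) : StrongDual ℝ FinSeq :=
  if h : ∃ B, ∀ n, ‖u n‖ ≤ B then
    (exists_weakStar_limit (hyperfilter ℕ) u h.choose_spec).choose else 0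

theorem tendsto_weakLim {u : ℕ → StrongDual ℝ FinSeq} {B : ℝ} (hu : ∀ n, ‖u n‖ ≤ B)
    (x : FinSeq) : Tendsto (fun n => u n x) (hyperfilter ℕ) (nhds (weakLim u x)) := by
  have h : ∃ B, ∀ n, ‖u n‖ ≤ B := ⟨B, hu⟩
  rw [weakLim, dif_pos h]
  exact (exists_weakStar_limit (hyperfilter ℕ) u h.choose_spec).choose_spec.2 x

theorem tendsto_limUnder_hyperfilter {u : ℕ → ℝ} {B : ℝ} (hu : ∀ n, |u n| ≤ B) :
    Tendsto u (hyperfilter ℕ) (nhds (limUnder (hyperfilter ℕ : Filter ℕ) u)) := by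
  refine tendsto_nhds_limUnder ?_
  obtain ⟨x, -, hx⟩ := (isCompact_Icc (a := -B) (b := B)).ultrafilter_le_nhds
    ((hyperfilter ℕ).map u) (by
      rw [le_principal_iff, Ultrafilter.mem_coe, Ultrafilter.mem_map]
      exact Filter.univ_mem' fun n => abs_le.1 (hu n))
  exact ⟨x, hx⟩

/-- The iterated weak-* limit of a function of increasing `k`-tuples. -/
noncomputable def iterLim : ℕ → (List ℕ → StrongDual ℝ FinSeq) → StrongDual ℝ FinSeq
  | 0, f => f []
  | k + 1, f => weakLim fun p => iterLim k fun l => f (p :: l)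

/-- The iterated limit over the first `i` variables of the coordinate limit of the iterated
weak-* limit over the remaining variables. -/
noncomputable def iterCoordLim : ℕ → ℕ → (List ℕ → StrongDual ℝ FinSeq) → ℝ
  | 0, k, f => coordLim (iterLim k f)
  | _ + 1, 0, _ => 0
  | i + 1, k + 1, f =>
    limUnder (hyperfilter ℕ : Filter ℕ) fun p => iterCoordLim i k fun l => f (p :: l)

section Limits

variable {f g : List ℕ → StrongDual ℝ FinSeq} {B : ℝ}

theorem norm_iterLim_le (k : ℕ) (hf : ∀ l, ‖f l‖ ≤ B) : ‖iterLim k f‖ ≤ B := by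
  induction k generalizing f with
  | zero => exact hf []
  | succ k ih =>
    have h : ∀ p, ‖iterLim k fun l => f (p :: l)‖ ≤ B := fun p => ih fun l => hf _
    exact norm_le_of_tendsto_apply (tendsto_weakLim h) (Eventually.of_forall h)

theorem tendsto_iterLim (k : ℕ) (hf : ∀ l, ‖f l‖ ≤ B) (x : FinSeq) :
    Tendsto (fun p => iterLim k (fun l => f (p :: l)) x) (hyperfilter ℕ)
      (nhds (iterLim (k + 1) f x)) :=
  tendsto_weakLim (fun _ => norm_iterLim_le k fun _ => hf _) x

theorem abs_iterCoordLim_le (i k : ℕ) (hf : ∀ l, ‖f l‖ ≤ B) : |iterCoordLim i k f| ≤ B := by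
  induction i generalizing k f with
  | zero =>
    rw [iterCoordLim]
    exact (abs_coordLim_le _).trans (norm_iterLim_le k hf)
  | succ i ih =>
    cases k with
    | zero =>
      rw [iterCoordLim, abs_zero]
      exact (norm_nonneg _).trans (hf [])
    | succ k =>
      rw [iterCoordLim]
      have h : ∀ p, |iterCoordLim i k fun l => f (p :: l)| ≤ B := fun p => ih k fun l => hf _
      exact le_of_tendsto (tendsto_limUnder_hyperfilter h).abs (Eventually.of_forall h)

theorem tendsto_iterCoordLim (i k : ℕ) (hf : ∀ l, ‖f l‖ ≤ B) :
    Tendsto (fun p => iterCoordLim i k fun l => f (p :: l)) (hyperfilter ℕ)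
      (nhds (iterCoordLim (i + 1) (k + 1) f)) :=
  tendsto_limUnder_hyperfilter fun _ => abs_iterCoordLim_le i k fun _ => hf _

/-- Increasing lists of length `k` with entries larger than `N`. -/
def IsIncreasing (N k : ℕ) (l : List ℕ) : Prop := l.length = k ∧ (N :: l).IsChain (· < ·)

theorem isIncreasing_cons {N k p : ℕ} {l : List ℕ} :
    IsIncreasing N (k + 1) (p :: l) ↔ N < p ∧ IsIncreasing p k l := by
  rw [IsIncreasing, IsIncreasing, List.length_cons, Nat.add_right_cancel_iff,
    List.isChain_cons_cons]
  tauto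

theorem IsIncreasing.mono {M N k : ℕ} {l : List ℕ} (h : IsIncreasing N k l) (hMN : M ≤ N) :
    IsIncreasing M k l := by
  cases l with
  | nil => exact ⟨h.1, by simp⟩
  | cons p l =>
    refine ⟨h.1, ?_⟩
    have := h.2
    rw [List.isChain_cons_cons] at this ⊢
    exact ⟨by omega, this.2⟩

theorem norm_iterLim_sub_le {N k : ℕ} {L : ℝ} (hf : ∀ l, ‖f l‖ ≤ B) (hg : ∀ l, ‖g l‖ ≤ B)
    (h : ∀ l, IsIncreasing N k l → ‖f l - g l‖ ≤ L) : ‖iterLim k f - iterLim k g‖ ≤ L := by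
  induction k generalizing f g N with
  | zero => exact h [] ⟨rfl, by simp⟩
  | succ k ih =>
    refine norm_le_of_tendsto_apply
      (u := fun p => iterLim k (fun l => f (p :: l)) - iterLim k (fun l => g (p :: l)))
      (fun x => (tendsto_iterLim k hf x).sub (tendsto_iterLim k hg x)) ?_
    filter_upwards [eventually_gt_hyperfilter N] with p hp
    exact ih (fun l => hf _) (fun l => hg _) fun l hl => h _ (isIncreasing_cons.2 ⟨hp, hl⟩)

/-- `f` moves by at most `L` when one entry of an increasing list is changed. -/
def IsLipschitzOnIncreasing (L : ℝ) (N k : ℕ) (f : List ℕ → StrongDual ℝ FinSeq) : Prop :=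
  ∀ s q q' r, IsIncreasing N k (s ++ q :: r) → IsIncreasing N k (s ++ q' :: r) →
    ‖f (s ++ q :: r) - f (s ++ q' :: r)‖ ≤ L

theorem IsLipschitzOnIncreasing.cons {L : ℝ} {N k p : ℕ}
    (h : IsLipschitzOnIncreasing L N (k + 1) f) (hp : N < p) :
    IsLipschitzOnIncreasing L p k fun l => f (p :: l) := fun s q q' r h1 h2 =>
  h (p :: s) q q' r (isIncreasing_cons.2 ⟨hp, h1⟩) (isIncreasing_cons.2 ⟨hp, h2⟩)

theorem IsLipschitzOnIncreasing.norm_sub_le {L : ℝ} {N k p : ℕ}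
    (h : IsLipschitzOnIncreasing L N (k + 1) f) (hf : ∀ l, ‖f l‖ ≤ B) (hp : N < p) :
    ‖iterLim k (fun l => f (p :: l)) - iterLim (k + 1) f‖ ≤ L := by
  refine norm_le_of_tendsto_apply
    (u := fun p' => iterLim k (fun l => f (p :: l)) - iterLim k (fun l => f (p' :: l)))
    (fun x => tendsto_const_nhds.sub (tendsto_iterLim k hf x)) ?_
  filter_upwards [eventually_gt_hyperfilter N] with p' hp'
  refine norm_iterLim_sub_le (N := max p p') (fun l => hf _) (fun l => hf _) fun l hl => ?_
  exact h [] p p' l (isIncreasing_cons.2 ⟨hp, hl.mono (le_max_left _ _)⟩)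
    (isIncreasing_cons.2 ⟨hp', hl.mono (le_max_right _ _)⟩)

theorem eventually_sum_coord_lt (k T : ℕ) (hf : ∀ l, ‖f l‖ ≤ B) {η : ℝ} (hη : 0 < η) :
    ∀ᶠ p in hyperfilter ℕ, ∑ n ∈ Finset.range T,
      |(iterLim k (fun l => f (p :: l)) - iterLim (k + 1) f) (unit n)| < η := by
  have h : Tendsto (fun p => ∑ n ∈ Finset.range T,
      |(iterLim k (fun l => f (p :: l)) - iterLim (k + 1) f) (unit n)|) (hyperfilter ℕ)
      (nhds (∑ n ∈ Finset.range T, |iterLim (k + 1) f (unit n) - iterLim (k + 1) f (unit n)|)) :=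
    tendsto_finsetSum _ fun n _ => ((tendsto_iterLim k hf (unit n)).sub tendsto_const_nhds).abs
  simp only [sub_self, abs_zero, Finset.sum_const_zero] at h
  exact h.eventually (gt_mem_nhds hη)

/-- Two functions with close iterated coordinate limits admit increasing lists, different at every
position, at which their difference is essentially a sum of `k` successive blocks. -/
theorem exists_block_decomposition {L η : ℝ} (hη : 0 < η) (hL : 0 ≤ L) {k N T : ℕ}
    (hf : ∀ l, ‖f l‖ ≤ B) (hg : ∀ l, ‖g l‖ ≤ B) (hfL : IsLipschitzOnIncreasing L N k f)
    (hgL : IsLipschitzOnIncreasing L N k g)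
    (hfg : ∀ i ≤ k, |iterCoordLim i k f - iterCoordLim i k g| < η) :
    ∃ m n : List ℕ, IsIncreasing N k m ∧ IsIncreasing N k n ∧ List.Forall₂ (· ≠ ·) m n ∧
      ∃ (t : ℕ → ℕ) (b : ℕ → StrongDual ℝ FinSeq), Monotone t ∧ t 0 = T ∧
        (∀ i, (b i).comp (restrL (t i) (t (i + 1))) = b i) ∧ (∀ i, ‖b i‖ ≤ 2 * L) ∧
        ‖f m - g n - (iterLim k f - iterLim k g) - ∑ i ∈ Finset.range k, b i‖ ≤ 4 * η * k := by
  induction k generalizing f g N T with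
  | zero =>
    exact ⟨[], [], ⟨rfl, by simp⟩, ⟨rfl, by simp⟩, .nil, fun _ => T, 0, monotone_const, rfl,
      by simp, by simpa using hL, by simp [iterLim]⟩
  | succ k ih =>
    have hp : ∀ᶠ p in hyperfilter ℕ, ∀ i ∈ Set.Iic k,
        |(iterCoordLim i k fun l => f (p :: l)) - iterCoordLim (i + 1) (k + 1) g| < η :=
      (Filter.eventually_all_finite (Set.finite_Iic k)).2 fun i hi =>
        ((tendsto_iterCoordLim i k hf).sub tendsto_const_nhds).abs.eventually
          (gt_mem_nhds (hfg (i + 1) (Nat.succ_le_succ hi)))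
    obtain ⟨p, hp, hpN, hpT⟩ := (hp.and ((eventually_gt_hyperfilter N).and
      (eventually_sum_coord_lt k T hf (half_pos hη)))).exists
    have hq : ∀ᶠ q in hyperfilter ℕ, ∀ i ∈ Set.Iic k,
        |(iterCoordLim i k fun l => f (p :: l)) - iterCoordLim i k fun l => g (q :: l)| < η :=
      (Filter.eventually_all_finite (Set.finite_Iic k)).2 fun i hi =>
        (tendsto_const_nhds.sub (tendsto_iterCoordLim i k hg)).abs.eventually
          (gt_mem_nhds (hp i hi))
    obtain ⟨q, hq, hqp, hqT⟩ := (hq.and ((eventually_gt_hyperfilter (max N p)).and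
      (eventually_sum_coord_lt k T hg (half_pos hη)))).exists
    have hqN : N < q := by omega
    set F := iterLim k fun l => f (p :: l) with hF
    set G := iterLim k fun l => g (q :: l) with hG
    obtain ⟨D, hD⟩ : ∃ D, D = (F - iterLim (k + 1) f) - (G - iterLim (k + 1) g) := ⟨_, rfl⟩
    have hDL : ‖D‖ ≤ 2 * L := by
      rw [hD]
      refine (norm_sub_le _ _).trans ?_
      linarith [hfL.norm_sub_le hf hpN, hgL.norm_sub_le hg hqN]
    have hDT : ∑ n ∈ Finset.range T, |D (unit n)| ≤ η := by
      have : ∑ n ∈ Finset.range T, |D (unit n)| ≤ ∑ n ∈ Finset.range T,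
          (|(F - iterLim (k + 1) f) (unit n)| + |(G - iterLim (k + 1) g) (unit n)|) :=
        Finset.sum_le_sum fun n _ => by
          rw [hD]
          exact abs_sub _ _
      rw [Finset.sum_add_distrib] at this
      linarith
    have hDc : |coordLim D| ≤ 2 * η := by
      have h1 := hq 0 (Nat.zero_le k)
      have h2 := hfg 0 (Nat.zero_le _)
      simp only [iterCoordLim] at h1 h2
      have : coordLim D = (coordLim F - coordLim G) -
          (coordLim (iterLim (k + 1) f) - coordLim (iterLim (k + 1) g)) := by
        rw [hD]
        simp only [map_sub]
        ring
      rw [this]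
      exact (abs_sub _ _).trans (by linarith)
    obtain ⟨T', hTT', hT'⟩ := exists_norm_sub_comp_restrL_le D hη hDT hDc
    obtain ⟨m, n, hm, hn, hmn, t, b, ht, ht0, hb, hbL, hsum⟩ := ih (f := fun l => f (p :: l))
      (g := fun l => g (q :: l)) (N := q) (T := T') (fun l => hf _) (fun l => hg _)
      (fun s a a' r h1 h2 => hfL.cons hpN s a a' r (h1.mono (by omega)) (h2.mono (by omega)))
      (hgL.cons hqN) fun i hi => hq i hi
    refine ⟨p :: m, q :: n, isIncreasing_cons.2 ⟨hpN, hm.mono (by omega)⟩,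
      isIncreasing_cons.2 ⟨hqN, hn⟩, .cons (by omega) hmn, fun i => Nat.casesOn i T t,
      fun i => Nat.casesOn i (D.comp (restrL T T')) b, ?_, rfl, ?_, ?_, ?_⟩
    · refine monotone_nat_of_le_succ fun i => ?_
      cases i with
      | zero => exact hTT'.trans_eq ht0.symm
      | succ i => exact ht (Nat.le_succ i)
    · intro i
      cases i with
      | zero =>
        ext x
        change D (restr T T' (restr T (t 0) x)) = D (restr T T' x)
        rw [ht0, restr_restr]
      | succ i => exact hb i
    · intro i
      cases i with
      | zero => exact (norm_comp_restrL_le _ _ _).trans hDL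
      | succ i => exact hbL i
    · rw [Finset.sum_range_succ']
      have : f (p :: m) - g (q :: n) - (iterLim (k + 1) f - iterLim (k + 1) g) -
          (∑ i ∈ Finset.range k, b i + D.comp (restrL T T')) =
          (f (p :: m) - g (q :: n) - (F - G) - ∑ i ∈ Finset.range k, b i) +
            (D - D.comp (restrL T T')) := by
        rw [hD]
        abel
      refine (congrArg norm this).trans_le ((norm_add_le _ _).trans ?_)
      push_cast
      linarith

end Limits

/-- Lipschitz functions on Hamming graphs concentrate in the dual. -/
theorem exists_norm_sub_le_of_isLipschitzOnIncreasing {f : List ℕ → StrongDual ℝ FinSeq} {B L : ℝ}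
    (hL : 0 ≤ L) {k : ℕ} (hf : ∀ l, ‖f l‖ ≤ B) (hfL : IsLipschitzOnIncreasing L 0 k f) :
    ∃ m n : List ℕ, IsIncreasing 0 k m ∧ IsIncreasing 0 k n ∧ List.Forall₂ (· ≠ ·) m n ∧
      ‖f m - f n‖ ≤ 4 * L + 1 := by
  obtain ⟨m, n, hm, hn, hmn, t, b, ht, ht0, hb, hbL, hsum⟩ := exists_block_decomposition
    (η := 1 / (4 * (k + 1))) (by positivity) hL (T := k) hf hf hfL hfL
    (fun i _ => by rw [sub_self, abs_zero]; positivity)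
  refine ⟨m, n, hm, hn, hmn, ?_⟩
  have h1 := norm_sum_blocks_le ht ht0.ge hb hbL
  rw [sub_self, sub_zero] at hsum
  have h2 : 4 * (1 / (4 * ((k : ℝ) + 1))) * k ≤ 1 := by
    have : 4 * (1 / (4 * ((k : ℝ) + 1))) * k = k / (k + 1) := by field_simp
    rw [this, div_le_one (by positivity)]
    linarith
  have h3 := norm_le_norm_add_norm_sub' (f m - f n) (∑ i ∈ Finset.range k, b i)
  linarith

/-- The tuple of the first `k` entries of a list. -/
def listTuple (k : ℕ) (l : List ℕ) : Fin k → ℕ := fun i => l.getD i 0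

theorem IsIncreasing.strictMono {N k : ℕ} {l : List ℕ} (h : IsIncreasing N k l) :
    StrictMono (listTuple k l) := by
  have h1 : l.Pairwise (· < ·) := (List.isChain_iff_pairwise.1 h.2).of_cons
  intro i j hij
  have hi : (i : ℕ) < l.length := by rw [h.1]; exact i.2
  have hj : (j : ℕ) < l.length := by rw [h.1]; exact j.2
  rw [listTuple, listTuple, List.getD_eq_getElem _ _ hi, List.getD_eq_getElem _ _ hj]
  exact List.pairwise_iff_getElem.1 h1 _ _ hi hj hij

theorem hammingDistH_listTuple_le_one (k : ℕ) (s r : List ℕ) (q q' : ℕ) :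
    hammingDistH (listTuple k (s ++ q :: r)) (listTuple k (s ++ q' :: r)) ≤ 1 := by
  refine Finset.card_le_one.2 fun i hi j hj => ?_
  have key : ∀ i : Fin k, listTuple k (s ++ q :: r) i ≠ listTuple k (s ++ q' :: r) i →
      (i : ℕ) = s.length := by
    intro i hi
    by_contra h
    refine hi ?_
    simp only [listTuple, List.getD_eq_getElem?_getD]
    congr 1
    rcases lt_or_gt_of_ne h with h | h
    · rw [List.getElem?_append_left h, List.getElem?_append_left h]
    · rw [List.getElem?_append_right h.le, List.getElem?_append_right h.le]
      obtain ⟨d, hd⟩ : ∃ d, (i : ℕ) - s.length = d + 1 := ⟨i - s.length - 1, by omega⟩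
      rw [hd, List.getElem?_cons_succ, List.getElem?_cons_succ]
  exact Fin.ext ((key i (Finset.mem_filter.1 hi).2).trans (key j (Finset.mem_filter.1 hj).2).symm)

theorem hammingDistH_listTuple_eq {k : ℕ} {m n : List ℕ} (hm : m.length = k)
    (h : List.Forall₂ (· ≠ ·) m n) : hammingDistH (listTuple k m) (listTuple k n) = k := by
  have hn : n.length = k := h.length_eq ▸ hm
  rw [hammingDistH, Finset.filter_true_of_mem, Finset.card_univ, Fintype.card_fin]
  intro i _
  have hi : (i : ℕ) < m.length := by rw [hm]; exact i.2
  have hi' : (i : ℕ) < n.length := by rw [hn]; exact i.2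
  rw [listTuple, listTuple, List.getD_eq_getElem _ _ hi, List.getD_eq_getElem _ _ hi']
  exact (List.forall₂_iff_get.1 h).2 i hi hi'

theorem not_hammingGraphsEquiCoarselyEmbed_dual :
    ¬ HammingGraphsEquiCoarselyEmbed (StrongDual ℝ FinSeq) := by
  classical
  rintro ⟨ρ, ω, -, hω, hρ, f, hf⟩
  obtain ⟨k, hk⟩ := ((hρ.comp tendsto_natCast_atTop_atTop).eventually_gt_atTop
    (4 * |ω 1| + 1)).exists
  let F : List ℕ → StrongDual ℝ FinSeq := fun l =>
    if IsIncreasing 0 k l then f k (listTuple k l) - f k (fun i => i) else 0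
  have hF : ∀ l, ‖F l‖ ≤ |ω k| := by
    intro l
    by_cases hl : IsIncreasing 0 k l
    · simp only [F, if_pos hl]
      refine (hf k _ _ hl.strictMono fun i j h => h).2.trans ((hω ?_).trans (le_abs_self _))
      exact_mod_cast (Finset.card_le_univ _).trans_eq (Fintype.card_fin k)
    · simp only [F, if_neg hl, norm_zero]
      exact abs_nonneg _
  have hFsub : ∀ l l', IsIncreasing 0 k l → IsIncreasing 0 k l' →
      F l - F l' = f k (listTuple k l) - f k (listTuple k l') := fun l l' hl hl' => by
    simp only [F, if_pos hl, if_pos hl']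
    abel
  have hFL : IsLipschitzOnIncreasing |ω 1| 0 k F := fun s q q' r h1 h2 => by
    rw [hFsub _ _ h1 h2]
    refine (hf k _ _ h1.strictMono h2.strictMono).2.trans ((hω ?_).trans (le_abs_self _))
    exact_mod_cast hammingDistH_listTuple_le_one k s r q q'
  obtain ⟨m, n, hm, hn, hmn, hle⟩ :=
    exists_norm_sub_le_of_isLipschitzOnIncreasing (abs_nonneg _) hF hFL
  rw [hFsub _ _ hm hn] at hle
  have h := (hf k _ _ hm.strictMono hn.strictMono).1
  rw [hammingDistH_listTuple_eq hm.1 hmn] at h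
  simp only [Function.comp_apply] at hk
  linarith

end FinSeq

/-- there is a non-reflexive Banach space `X` into which the Hamming graphs do
not equi-coarsely embed. -/
theorem statement_15 :
    ∃ (X : Type) (_ : NormedAddCommGroup X) (_ : NormedSpace ℝ X),
      CompleteSpace X ∧ ¬ IsReflexiveSpace X ∧ ¬ HammingGraphsEquiCoarselyEmbed X := by
  exact ⟨StrongDual ℝ FinSeq, inferInstance, inferInstance, inferInstance,
    FinSeq.not_isReflexiveSpace_dual, FinSeq.not_hammingGraphsEquiCoarselyEmbed_dual⟩
end

section
/- Let X be a Banach space and n ∈ ℕ. Then X has dimension less than n if and only if the integer grid ℤ^n, equipped with the ℓ₁ metric d(x,y) = ∑_{i=1}^n |x_i − y_i|, does not coarsely embed into X. -/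
open Finset Filter

/-- The `ℓ₁` distance on the integer grid `ℤ^n`. -/
def l1dist {n : ℕ} (x y : Fin n → ℤ) : ℝ :=
  ∑ i, |(x i : ℝ) - (y i : ℝ)|

/-- The integer grid `ℤ^n` with the `ℓ₁` metric coarsely embeds into `X`:
there is `g : ℤ^n → X` with `ω_g(t) < ∞` for all `t` and `ρ_g(t) → ∞` as `t → ∞`. -/
def ZnCoarselyEmbeds (n : ℕ) (X : Type*) [NormedAddCommGroup X] : Prop :=
  ∃ g : (Fin n → ℤ) → X,
    (∀ t : ℝ, ∃ B : ℝ, ∀ x y : Fin n → ℤ, l1dist x y ≤ t → ‖g x - g y‖ ≤ B) ∧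
    (∀ A : ℝ, ∃ t : ℝ, ∀ x y : Fin n → ℤ, t ≤ l1dist x y → A ≤ ‖g x - g y‖)

theorem znCoarselyEmbeds_of_antilipschitz {X : Type*} [NormedAddCommGroup X] [NormedSpace ℝ X]
    {n : ℕ} (φ : (Fin n → ℝ) →L[ℝ] X) (K : NNReal) (hφ : AntilipschitzWith K φ) :
    ZnCoarselyEmbeds n X := by
  have key : ∀ x y : Fin n → ℤ, φ (fun i => (x i : ℝ)) - φ (fun i => (y i : ℝ)) =
      φ (fun i => (x i : ℝ) - (y i : ℝ)) := by
    intro x y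
    rw [← map_sub]
    rfl
  refine ⟨fun x => φ (fun i => (x i : ℝ)), fun t => ⟨‖φ‖ * t, fun x y h => ?_⟩,
    fun A => ⟨n * (K * A) + 1, fun x y h => ?_⟩⟩
  · rw [key]
    refine (φ.le_opNorm _).trans (mul_le_mul_of_nonneg_left (le_trans ?_ h) (norm_nonneg _))
    refine (pi_norm_le_iff_of_nonneg (Finset.sum_nonneg fun i _ => abs_nonneg _)).2 fun i => ?_
    exact Finset.single_le_sum (f := fun i => |(x i : ℝ) - (y i : ℝ)|)
      (fun i _ => abs_nonneg _) (Finset.mem_univ i)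
  · by_contra! hA
    rw [key] at hA
    set v : Fin n → ℝ := fun i => (x i : ℝ) - (y i : ℝ)
    have h1 : ‖v‖ ≤ K * ‖φ v‖ := by
      simpa [dist_zero_right] using hφ.le_mul_dist v 0
    have h2 : l1dist x y ≤ n * ‖v‖ := by
      have : ∑ i, |(x i : ℝ) - (y i : ℝ)| ≤ ∑ _i : Fin n, ‖v‖ :=
        Finset.sum_le_sum fun i _ => norm_le_pi_norm v i
      simpa [l1dist] using this
    have h3 : (n : ℝ) * ‖v‖ ≤ n * (K * A) := by
      gcongr
      exact h1.trans (by gcongr)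
    linarith

theorem znCoarselyEmbeds_of_le_rank {X : Type*} [NormedAddCommGroup X] [NormedSpace ℝ X]
    {n : ℕ} (h : (n : Cardinal) ≤ Module.rank ℝ X) : ZnCoarselyEmbeds n X := by
  obtain ⟨v, hv⟩ := exists_linearIndependent_of_le_rank h
  let φ := LinearMap.toContinuousLinearMap (Fintype.linearCombination ℝ v)
  have hker : (Fintype.linearCombination ℝ v).ker = ⊥ :=
    LinearMap.ker_eq_bot.2 (hv.fintypeLinearCombination_injective)
  obtain ⟨K, -, hK⟩ := (Fintype.linearCombination ℝ v).exists_antilipschitzWith hker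
  exact znCoarselyEmbeds_of_antilipschitz φ K hK

/-- A map on `ℕ^n` moving neighbours by at most `B` grows at most linearly. -/
theorem norm_sub_zero_le_mul_sum {E : Type*} [SeminormedAddCommGroup E] {n : ℕ}
    (h : (Fin n → ℕ) → E) (B : ℝ)
    (hB : ∀ z i, ‖h (z + Pi.single i 1) - h z‖ ≤ B) (z : Fin n → ℕ) :
    ‖h z - h 0‖ ≤ B * ∑ i, (z i : ℝ) := by
  obtain ⟨k, hk⟩ : ∃ k, ∑ i, z i = k := ⟨_, rfl⟩
  induction k generalizing z with
  | zero =>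
    obtain rfl : z = 0 := by
      ext i
      exact (Finset.sum_eq_zero_iff.1 hk) i (Finset.mem_univ i)
    simp
  | succ k ih =>
    obtain ⟨i, -, hi⟩ : ∃ i ∈ Finset.univ, z i ≠ 0 :=
      Finset.exists_ne_zero_of_sum_ne_zero (by omega)
    obtain ⟨w, rfl⟩ : ∃ w, z = w + Pi.single i 1 := by
      refine ⟨z - Pi.single i 1, (tsub_add_cancel_of_le fun j => ?_).symm⟩
      by_cases hj : j = i
      · subst hj
        simpa using Nat.one_le_iff_ne_zero.2 hi
      · simp [hj]
    have hs : ∑ j, (w + Pi.single i 1 : Fin n → ℕ) j = ∑ j, w j + 1 := by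
      simp [Finset.sum_add_distrib]
    have hs' : ∑ j, (((w + Pi.single i 1 : Fin n → ℕ) j : ℕ) : ℝ) = ∑ j, (w j : ℝ) + 1 := by
      exact_mod_cast hs
    have h1 := ih w (by omega)
    calc ‖h (w + Pi.single i 1) - h 0‖
        ≤ ‖h (w + Pi.single i 1) - h w‖ + ‖h w - h 0‖ := norm_sub_le_norm_sub_add_norm_sub ..
      _ ≤ B + B * ∑ j, (w j : ℝ) := add_le_add (hB w i) h1
      _ = _ := by rw [hs']; ring

/-- Counting: a map from `ℕ^n` to `ℝ^m` that grows at most linearly and whose integer part is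
injective forces `n ≤ m`. -/
theorem le_of_injective_floor {n m : ℕ} (h : (Fin n → ℕ) → Fin m → ℝ) (B : ℝ)
    (hB : ∀ z i, |h z i| ≤ B * ∑ j, (z j : ℝ))
    (hinj : Function.Injective fun z i => ⌊h z i⌋) : n ≤ m := by
  by_contra! hmn
  obtain ⟨K, hK⟩ := exists_nat_ge (|B| * n)
  have count : ∀ r : ℕ, 1 ≤ r → r ^ n ≤ (2 * (K * r) + 1) ^ m := by
    intro r hr
    have hc := Finset.card_le_card_of_injOn (s := Fintype.piFinset fun _ : Fin n => Finset.range r)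
      (t := Fintype.piFinset fun _ : Fin m => Finset.Icc (-((K * r : ℕ) : ℤ)) ((K * r : ℕ) : ℤ))
      (fun z i => ⌊h z i⌋) ?_ hinj.injOn
    · simp only [Fintype.card_piFinset_const, Finset.card_range, Int.card_Icc] at hc
      convert hc using 2
      omega
    · intro z hz
      simp only [Finset.mem_coe, Fintype.mem_piFinset, Finset.mem_range] at hz
      simp only [Finset.mem_coe, Fintype.mem_piFinset, Finset.mem_Icc]
      intro i
      have hs : ∑ j, (z j : ℝ) ≤ n * r := by
        have : ∑ j, (z j : ℝ) ≤ ∑ _j : Fin n, (r : ℝ) :=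
          Finset.sum_le_sum fun j _ => by exact_mod_cast (hz j).le
        simpa using this
      have hb : |h z i| ≤ ((K * r : ℕ) : ℝ) := by
        calc |h z i| ≤ B * ∑ j, (z j : ℝ) := hB z i
          _ ≤ |B| * (n * r) := by
            gcongr
            exact le_abs_self B
          _ = |B| * n * r := by ring
          _ ≤ K * r := by gcongr
          _ = _ := by push_cast; ring
      obtain ⟨hl, hu⟩ := abs_le.1 hb
      constructor
      · rw [Int.le_floor]
        exact_mod_cast hl
      · have := (Int.floor_le (h z i)).trans hu
        exact_mod_cast this
  set r := (2 * K + 1) ^ m + 1 with hr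
  have h1 := count r (by omega)
  have h2 : r ^ (m + 1) ≤ r ^ n := Nat.pow_le_pow_right (by omega) hmn
  have h3 : (2 * (K * r) + 1) ^ m ≤ (2 * K + 1) ^ m * r ^ m := by
    rw [← mul_pow]
    exact Nat.pow_le_pow_left (by nlinarith [show 1 ≤ r by omega]) m
  have h4 : r * r ^ m ≤ (2 * K + 1) ^ m * r ^ m := by
    rw [← pow_succ']
    exact h2.trans (h1.trans h3)
  have h5 := Nat.le_of_mul_le_mul_right h4 (by positivity)
  omega

theorem ZnCoarselyEmbeds.le_finrank {X : Type*} [NormedAddCommGroup X] [NormedSpace ℝ X]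
    [FiniteDimensional ℝ X] {n : ℕ} (hX : ZnCoarselyEmbeds n X) : n ≤ Module.finrank ℝ X := by
  obtain ⟨g, hω, hρ⟩ := hX
  let e : X ≃L[ℝ] (Fin (Module.finrank ℝ X) → ℝ) := ContinuousLinearEquiv.ofFinrankEq (by simp)
  obtain ⟨t, ht⟩ := hρ (‖(e.symm : (Fin (Module.finrank ℝ X) → ℝ) →L[ℝ] X)‖ + 1)
  obtain ⟨T, hT⟩ := exists_nat_ge t
  obtain ⟨B, hB⟩ := hω T
  let s : (Fin n → ℕ) → Fin n → ℤ := fun z i => T * z i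
  have hs : ∀ z w, l1dist (s z) (s w) = T * ∑ i, |(z i : ℝ) - (w i : ℝ)| := by
    intro z w
    rw [l1dist, Finset.mul_sum]
    refine Finset.sum_congr rfl fun i _ => ?_
    simp only [s]
    push_cast
    rw [← mul_sub, abs_mul, Nat.abs_cast]
  let E : ℝ := ‖(e : X →L[ℝ] (Fin (Module.finrank ℝ X) → ℝ))‖
  have step : ∀ z i, ‖e (g (s (z + Pi.single i 1))) - e (g (s z))‖ ≤ E * B := by
    intro z i
    rw [← map_sub]
    refine ((e : X →L[ℝ] (Fin (Module.finrank ℝ X) → ℝ)).le_opNorm _).trans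
      (mul_le_mul_of_nonneg_left (hB _ _ ?_) (norm_nonneg _))
    rw [hs]
    simp [← Nat.cast_sum]
  refine le_of_injective_floor (fun z => e (g (s z)) - e (g (s 0))) (E * B)
    (fun z i => (norm_le_pi_norm (e (g (s z)) - e (g (s 0))) i).trans
      (norm_sub_zero_le_mul_sum (fun z => e (g (s z))) _ step z)) ?_
  intro z w hzw
  by_contra hne
  obtain ⟨i, hi⟩ := Function.ne_iff.1 hne
  have hfar : t ≤ l1dist (s z) (s w) := by
    rw [hs]
    have h1 : (1 : ℝ) ≤ |(z i : ℝ) - (w i : ℝ)| := by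
      have : (1 : ℤ) ≤ |(z i : ℤ) - (w i : ℤ)| :=
        Int.one_le_abs (sub_ne_zero.2 (by exact_mod_cast hi))
      exact_mod_cast this
    have h2 := Finset.single_le_sum (f := fun i => |(z i : ℝ) - (w i : ℝ)|)
      (fun i _ => abs_nonneg _) (Finset.mem_univ i)
    have h3 : (T : ℝ) * 1 ≤ T * ∑ i, |(z i : ℝ) - (w i : ℝ)| := by
      gcongr
      exact h1.trans h2
    linarith
  have hclose : ‖e (g (s z)) - e (g (s w))‖ ≤ 1 := by
    refine (pi_norm_le_iff_of_nonneg zero_le_one).2 fun j => ?_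
    have := Int.abs_sub_lt_one_of_floor_eq_floor (congrFun hzw j)
    simpa using this.le
  have h4 := (e.symm : (Fin (Module.finrank ℝ X) → ℝ) →L[ℝ] X).le_opNorm
    (e (g (s z)) - e (g (s w)))
  have h5 := ht _ _ hfar
  have h6 : (e.symm : (Fin (Module.finrank ℝ X) → ℝ) →L[ℝ] X) (e (g (s z)) - e (g (s w))) =
      g (s z) - g (s w) := by
    simp
  rw [h6] at h4
  have h7 := mul_le_mul_of_nonneg_left hclose
    (norm_nonneg (e.symm : (Fin (Module.finrank ℝ X) → ℝ) →L[ℝ] X))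
  linarith

/-- a Banach space `X` has dimension less than `n` if and only if the integer
grid `ℤ^n` with the `ℓ₁` metric does not coarsely embed into `X`. -/
theorem statement_17 {X : Type*} [NormedAddCommGroup X] [NormedSpace ℝ X] [CompleteSpace X]
    (n : ℕ) :
    Module.rank ℝ X < n ↔ ¬ ZnCoarselyEmbeds n X := by
  refine ⟨fun h hX => ?_, fun h => lt_of_not_ge fun hn => h (znCoarselyEmbeds_of_le_rank hn)⟩
  have : FiniteDimensional ℝ X :=
    Module.rank_lt_aleph0_iff.1 (h.trans (Cardinal.natCast_lt_aleph0))
  rw [← Module.finrank_eq_rank, Nat.cast_lt] at h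
  exact h.not_ge hX.le_finrank
end
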